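/- arXiv:1907.07866 — 2 statements merged into one kernel-verified Lean document; each statement's English description precedes it below -/
import Mathlib

section
/- Let G be a connected finite simple graph with minimum degree δ(G) ≥ 2. Then G is (γ,γ₂)-perfect if and only if G contains no subgraph (not necessarily induced) isomorphic to T₆, to the path P₈ on 8 vertices, or to a cycle C_m for any m ≥ 3 with m ≠ 4. -/
/-- A set `D` is a `k`-dominating set of `G` if every vertex outside `D`
has at least `k` neighbors in `D`. -/
def kDomSet {V : Type*} (G : SimpleGraph V) (k : ℕ) (D : Set V) : Prop :=
  ∀ v ∉ D, k ≤ (D ∩ G.neighborSet v).ncard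

/-- The `k`-domination number: minimum size of a `k`-dominating set. -/
noncomputable def kDomNum {V : Type*} [Fintype V] (G : SimpleGraph V) (k : ℕ) : ℕ :=
  sInf {n | ∃ D : Set V, kDomSet G k D ∧ D.ncard = n}
/-- `G` contains a subgraph (not necessarily induced) isomorphic to `H`. -/
def containsSub {VH VG : Type*} (H : SimpleGraph VH) (G : SimpleGraph VG) : Prop :=
  ∃ φ : VH → VG, Function.Injective φ ∧ ∀ a b, H.Adj a b → G.Adj (φ a) (φ b)

/-- The tree `T₆`: an edge `0 1` with pendant vertices `2, 3` attached to `0`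
and pendant vertices `4, 5` attached to `1`. -/
def T6 : SimpleGraph (Fin 6) :=
  SimpleGraph.fromRel (fun a b =>
    (a = 0 ∧ b = 1) ∨ (a = 0 ∧ b = 2) ∨ (a = 0 ∧ b = 3) ∨
    (a = 1 ∧ b = 4) ∨ (a = 1 ∧ b = 5))

/-- The cycle `C_m` on `Fin m` (for `m ≥ 3`). -/
def cycleG (m : ℕ) : SimpleGraph (Fin m) :=
  SimpleGraph.fromRel (fun a b => (b : ℕ) = ((a : ℕ) + 1) % m)


namespace S16
variable {V : Type*}

def Perf (G : SimpleGraph V) (S : Set V) : Prop :=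
  ∀ D ⊆ S, (∀ v ∈ S, v ∉ D → ∃ x ∈ D, G.Adj v x) →
    ∃ D' ⊆ S, D'.ncard ≤ D.ncard ∧
      ∀ v ∈ S, v ∉ D' → ∃ x ∈ D', ∃ y ∈ D', x ≠ y ∧ G.Adj v x ∧ G.Adj v y

theorem one_le_iff {W : Type*} [Finite W] (H : SimpleGraph W) (D : Set W) (v : W) :
    1 ≤ (D ∩ H.neighborSet v).ncard ↔ ∃ x ∈ D, H.Adj v x := by
  rw [Nat.one_le_iff_ne_zero, ← Nat.pos_iff_ne_zero, Set.ncard_pos]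
  rfl

theorem two_le_iff {W : Type*} [Finite W] (T : Set W) :
    2 ≤ T.ncard ↔ ∃ x ∈ T, ∃ y ∈ T, x ≠ y := by
  have := Set.one_lt_ncard_iff (s := T) (Set.toFinite T)
  constructor
  · intro h
    obtain ⟨a, b, ha, hb, hab⟩ := this.1 h
    exact ⟨a, ha, b, hb, hab⟩
  · rintro ⟨a, ha, b, hb, hab⟩
    exact this.2 ⟨a, b, ha, hb, hab⟩

theorem kDomNum_eq_iff {W : Type*} [Fintype W] (H : SimpleGraph W) :
    kDomNum H 1 = kDomNum H 2 ↔ ∀ D : Set W, kDomSet H 1 D → ∃ D' : Set W,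
      kDomSet H 2 D' ∧ D'.ncard ≤ D.ncard := by
  have ne : ∀ k, {n | ∃ D : Set W, kDomSet H k D ∧ D.ncard = n}.Nonempty := fun k =>
    ⟨_, Set.univ, fun v hv => absurd (Set.mem_univ v) hv, rfl⟩
  constructor
  · intro h D hD
    obtain ⟨D', h1, h2⟩ := Nat.sInf_mem (ne 2)
    refine ⟨D', h1, ?_⟩
    rw [h2]
    change kDomNum H 2 ≤ _
    rw [← h]
    exact Nat.sInf_le ⟨D, hD, rfl⟩
  · intro h
    apply le_antisymm
    · obtain ⟨D', h1, h2⟩ := Nat.sInf_mem (ne 2)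
      exact Nat.sInf_le ⟨D', fun v hv => le_trans (by norm_num) (h1 v hv), h2⟩
    · obtain ⟨D, h1, h2⟩ := Nat.sInf_mem (ne 1)
      obtain ⟨D', h3, h4⟩ := h D h1
      change _ ≤ sInf _
      rw [← h2]
      exact le_trans (Nat.sInf_le ⟨D', h3, rfl⟩) h4

theorem bridge [Fintype V] (G : SimpleGraph V) (s : Finset V) :
    kDomNum (G.induce (↑s : Set V)) 1 = kDomNum (G.induce (↑s : Set V)) 2 ↔
      Perf G (↑s : Set V) := by
  rw [kDomNum_eq_iff]
  have e1 : ∀ D : Set (↑s : Set V), kDomSet (G.induce (↑s : Set V)) 1 D ↔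
      ∀ v ∈ (↑s : Set V), v ∉ Subtype.val '' D → ∃ x ∈ Subtype.val '' D, G.Adj v x := by
    intro D
    simp only [kDomSet, one_le_iff]
    constructor
    · rintro h v hv hvD
      obtain ⟨x, hx, hx'⟩ := h ⟨v, hv⟩ (fun h => hvD ⟨_, h, rfl⟩)
      exact ⟨x, ⟨x, hx, rfl⟩, hx'⟩
    · rintro h ⟨v, hv⟩ hvD
      obtain ⟨_, ⟨x, hx, rfl⟩, hx'⟩ := h v hv (by
        rintro ⟨w, hw, rfl⟩
        exact hvD hw)
      exact ⟨x, hx, hx'⟩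
  have e2 : ∀ D : Set (↑s : Set V), kDomSet (G.induce (↑s : Set V)) 2 D ↔
      ∀ v ∈ (↑s : Set V), v ∉ Subtype.val '' D → ∃ x ∈ Subtype.val '' D,
        ∃ y ∈ Subtype.val '' D, x ≠ y ∧ G.Adj v x ∧ G.Adj v y := by
    intro D
    simp only [kDomSet, two_le_iff]
    constructor
    · rintro h v hv hvD
      obtain ⟨x, ⟨hx, hx'⟩, y, ⟨hy, hy'⟩, hxy⟩ := h ⟨v, hv⟩ (fun h => hvD ⟨_, h, rfl⟩)
      exact ⟨x, ⟨x, hx, rfl⟩, y, ⟨y, hy, rfl⟩, fun h => hxy (Subtype.ext h), hx', hy'⟩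
    · rintro h ⟨v, hv⟩ hvD
      obtain ⟨_, ⟨x, hx, rfl⟩, _, ⟨y, hy, rfl⟩, hxy, hx', hy'⟩ := h v hv (by
        rintro ⟨w, hw, rfl⟩
        exact hvD hw)
      exact ⟨x, ⟨hx, hx'⟩, y, ⟨hy, hy'⟩, fun h => hxy (congrArg _ h)⟩
  have nc : ∀ D : Set (↑s : Set V), (Subtype.val '' D).ncard = D.ncard := fun D =>
    Set.ncard_image_of_injective _ Subtype.val_injective
  have sub : ∀ D : Set (↑s : Set V), Subtype.val '' D ⊆ (↑s : Set V) := by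
    rintro D _ ⟨x, _, rfl⟩
    exact x.2
  have lift : ∀ D : Set V, D ⊆ ↑s → ∃ E : Set (↑s : Set V), Subtype.val '' E = D := by
    intro D hD
    exact ⟨Subtype.val ⁻¹' D, by rw [Subtype.image_preimage_coe]; exact Set.inter_eq_right.2 hD⟩
  constructor
  · intro h D hD hdom
    obtain ⟨E, rfl⟩ := lift D hD
    obtain ⟨E', h1, h2⟩ := h E ((e1 E).2 hdom)
    exact ⟨Subtype.val '' E', sub E', by rw [nc, nc]; exact h2, (e2 E').1 h1⟩
  · intro h D hD
    obtain ⟨D', h0, h1, h2⟩ := h (Subtype.val '' D) (sub D) ((e1 D).1 hD)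
    obtain ⟨E, rfl⟩ := lift D' h0
    rw [nc, nc] at h1
    exact ⟨E, (e2 E).2 h2, h1⟩

def MinDeg2 (G : SimpleGraph V) (S : Set V) : Prop :=
  ∀ v ∈ S, ∃ x ∈ S, ∃ y ∈ S, x ≠ y ∧ G.Adj v x ∧ G.Adj v y

theorem bridge_deg [Fintype V] (G : SimpleGraph V) (s : Finset V) :
    (∀ x : (↑s : Set V), 2 ≤ ((G.induce (↑s : Set V)).neighborSet x).ncard) ↔
      MinDeg2 G (↑s : Set V) := by
  simp only [two_le_iff]
  constructor
  · rintro h v hv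
    obtain ⟨x, hx, y, hy, hxy⟩ := h ⟨v, hv⟩
    exact ⟨x, x.2, y, y.2, fun h => hxy (Subtype.ext h), hx, hy⟩
  · rintro h ⟨v, hv⟩
    obtain ⟨x, hx, y, hy, hxy, h1, h2⟩ := h v hv
    exact ⟨⟨x, hx⟩, h1, ⟨y, hy⟩, h2, fun h => hxy (congrArg Subtype.val h)⟩

def HasCyc (G : SimpleGraph V) (m : ℕ) : Prop :=
  ∃ c : ℕ → V, (∀ i < m, ∀ j < m, c i = c j → i = j) ∧
    (∀ i, i + 1 < m → G.Adj (c i) (c (i+1))) ∧ G.Adj (c (m-1)) (c 0)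

theorem hasCyc_of (G : SimpleGraph V) (m : ℕ) (hm : 3 ≤ m) (h : containsSub (cycleG m) G) :
    HasCyc G m := by
  obtain ⟨φ, hinj, hadj⟩ := h
  have hm0 : 0 < m := by omega
  refine ⟨fun i => φ ⟨i % m, Nat.mod_lt _ hm0⟩, ?_, ?_, ?_⟩
  · intro i hi j hj h
    have := hinj h
    simpa [Nat.mod_eq_of_lt hi, Nat.mod_eq_of_lt hj] using this
  · intro i hi
    apply hadj
    simp [cycleG, Nat.mod_eq_of_lt hi, Nat.mod_eq_of_lt (show i < m by omega)]
  · apply hadj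
    have : m - 1 + 1 = m := by omega
    simp [cycleG, Nat.mod_eq_of_lt (show m - 1 < m by omega), this]
    omega

theorem contains_of (G : SimpleGraph V) (m : ℕ) (hm : 3 ≤ m) (φ : Fin m → V)
    (hi : Function.Injective φ)
    (h : ∀ i : Fin m, G.Adj (φ i) (φ ⟨((i : ℕ) + 1) % m, Nat.mod_lt _ (by omega)⟩)) :
    containsSub (cycleG m) G := by
  refine ⟨φ, hi, ?_⟩
  rintro a b hab
  simp only [cycleG, SimpleGraph.fromRel_adj] at hab
  obtain ⟨_, h1 | h1⟩ := hab
  · have := h a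
    convert this
  · have := (h b).symm
    convert this

theorem hasCyc_3 (G : SimpleGraph V) (a b c : V) (h1 : G.Adj a b) (h2 : G.Adj b c)
    (h3 : G.Adj c a) : containsSub (cycleG 3) G := by
  refine contains_of G 3 (by norm_num) ![a, b, c] ?_ ?_
  · rw [← List.nodup_ofFn]
    simp [h1.ne, h2.ne, h3.ne.symm]
  · simp [Fin.forall_fin_succ, *]

theorem hasCyc_5 (G : SimpleGraph V) (a b c d e : V) (hn : [a,b,c,d,e].Nodup)
    (h1 : G.Adj a b) (h2 : G.Adj b c)
    (h3 : G.Adj c d) (h4 : G.Adj d e) (h5 : G.Adj e a) : containsSub (cycleG 5) G := by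
  refine contains_of G 5 (by norm_num) ![a, b, c, d, e] ?_ ?_
  · rw [← List.nodup_ofFn]
    simpa using hn
  · simp [Fin.forall_fin_succ, *]

theorem hasCyc_6 (G : SimpleGraph V) (a b c d e f : V) (hn : [a,b,c,d,e,f].Nodup)
    (h1 : G.Adj a b) (h2 : G.Adj b c)
    (h3 : G.Adj c d) (h4 : G.Adj d e) (h5 : G.Adj e f) (h6 : G.Adj f a) :
    containsSub (cycleG 6) G := by
  refine contains_of G 6 (by norm_num) ![a, b, c, d, e, f] ?_ ?_
  · rw [← List.nodup_ofFn]
    simpa using hn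
  · simp [Fin.forall_fin_succ, *]

theorem hasCyc_7 (G : SimpleGraph V) (a b c d e f g : V) (hn : [a,b,c,d,e,f,g].Nodup)
    (h1 : G.Adj a b) (h2 : G.Adj b c)
    (h3 : G.Adj c d) (h4 : G.Adj d e) (h5 : G.Adj e f) (h6 : G.Adj f g) (h7 : G.Adj g a) :
    containsSub (cycleG 7) G := by
  refine contains_of G 7 (by norm_num) ![a, b, c, d, e, f, g] ?_ ?_
  · rw [← List.nodup_ofFn]
    simpa using hn
  · simp [Fin.forall_fin_succ, *]

theorem hasP8 (G : SimpleGraph V) (a b c d e f g h : V) (hn : [a,b,c,d,e,f,g,h].Nodup)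
    (h1 : G.Adj a b) (h2 : G.Adj b c)
    (h3 : G.Adj c d) (h4 : G.Adj d e) (h5 : G.Adj e f) (h6 : G.Adj f g) (h7 : G.Adj g h) :
    containsSub (SimpleGraph.pathGraph 8) G := by
  have key : ∀ i : Fin 8, ∀ hi : (i : ℕ) + 1 < 8,
      G.Adj (![a, b, c, d, e, f, g, h] i) (![a, b, c, d, e, f, g, h] ⟨i + 1, hi⟩) := by
    simp [Fin.forall_fin_succ, *]
  refine ⟨![a, b, c, d, e, f, g, h], ?_, ?_⟩
  · rw [← List.nodup_ofFn]
    simpa using hn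
  · intro x y hxy
    rw [SimpleGraph.pathGraph_adj] at hxy
    obtain h1 | h1 := hxy
    · have := key x (by omega)
      convert this
      exact h1.symm
    · have := (key y (by omega)).symm
      convert this
      exact h1.symm

theorem hasT6 (G : SimpleGraph V) (a b c d e f : V) (hn : [a,b,c,d,e,f].Nodup)
    (h1 : G.Adj a b) (h2 : G.Adj a c)
    (h3 : G.Adj a d) (h4 : G.Adj b e) (h5 : G.Adj b f) :
    containsSub T6 G := by
  refine ⟨![a, b, c, d, e, f], ?_, ?_⟩
  · rw [← List.nodup_ofFn]
    simpa using hn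
  · intro x y hxy
    simp only [T6, SimpleGraph.fromRel_adj] at hxy
    rcases hxy with ⟨_, (h | h | h | h | h) | (h | h | h | h | h)⟩ <;>
      (obtain ⟨rfl, rfl⟩ := h; simp [*, G.adj_comm])

theorem conn_ind (G : SimpleGraph V) (hc : G.Connected) (P : V → Prop) (a : V) (ha : P a)
    (h : ∀ v w, P v → G.Adj v w → P w) (v : V) : P v := by
  obtain ⟨w⟩ := hc.preconnected a v
  induction w with
  | nil => exact ha
  | cons hadj _ ih => exact ih (h _ _ ha hadj)

theorem struct [Fintype V] (G : SimpleGraph V) (hc : G.Connected)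
    (hd : ∀ v, ∃ x y, x ≠ y ∧ G.Adj v x ∧ G.Adj v y)
    (hT : ¬ containsSub T6 G) (hP : ¬ containsSub (SimpleGraph.pathGraph 8) G)
    (hC : ∀ m : ℕ, 3 ≤ m → m ≠ 4 → ¬ containsSub (cycleG m) G) :
    ∃ a, (∀ b, G.Adj a b → ∃ o, o ≠ a ∧ ∀ w, G.Adj b w ↔ w = a ∨ w = o) ∧
      (∀ v, v = a ∨ G.Adj a v ∨ ∃ b, G.Adj a b ∧ G.Adj b v) := by
  have tri : ∀ x y z, G.Adj x y → G.Adj y z → G.Adj z x → False := fun x y z h1 h2 h3 =>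
    hC 3 (by norm_num) (by norm_num) (hasCyc_3 G x y z h1 h2 h3)
  have := hc.nonempty
  obtain ⟨a, hmax⟩ := Finite.exists_max (fun v => (G.neighborSet v).ncard)
  have h2 : ∀ b, G.Adj a b → ∃ o, o ≠ a ∧ ∀ w, G.Adj b w ↔ w = a ∨ w = o := by
    intro b hab
    have : ∃ o, o ≠ a ∧ G.Adj b o := by
      obtain ⟨x, y, hxy, hx, hy⟩ := hd b
      by_cases h : x = a
      · exact ⟨y, fun h' => hxy (h.trans h'.symm), hy⟩
      · exact ⟨x, h, hx⟩
    obtain ⟨o, hoa, hbo⟩ := this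
    refine ⟨o, hoa, fun w => ⟨fun hbw => ?_, ?_⟩⟩
    · by_contra hw
      push Not at hw
      obtain ⟨hwa, hwo⟩ := hw
      have h3 : ({a, o, w} : Set V).ncard = 3 :=
        Set.ncard_eq_three.2 ⟨a, o, w, hoa.symm, hwa.symm, hwo.symm, rfl⟩
      have h4 : ({a, o, w} : Set V).ncard ≤ (G.neighborSet b).ncard := by
        apply Set.ncard_le_ncard _ (Set.toFinite _)
        rintro x (rfl | rfl | rfl)
        exacts [hab.symm, hbo, hbw]
      have h5 := hmax b
      have h6 : 2 ≤ (G.neighborSet a \ {b}).ncard := by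
        rw [Set.ncard_sdiff_singleton_of_mem (show b ∈ G.neighborSet a from hab)]
        omega
      obtain ⟨p, ⟨hp, hpb⟩, q, ⟨hq, hqb⟩, hpq⟩ := (two_le_iff _).1 h6
      simp only [SimpleGraph.mem_neighborSet, Set.mem_singleton_iff] at hp hq hpb hqb
      refine hT (hasT6 G a b p q o w ?_ hab hp hq hbo hbw)
      have e1 : p ≠ o := by rintro rfl; exact tri _ _ _ hab hbo hp.symm
      have e2 : p ≠ w := by rintro rfl; exact tri _ _ _ hab hbw hp.symm
      have e3 : q ≠ o := by rintro rfl; exact tri _ _ _ hab hbo hq.symm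
      have e4 : q ≠ w := by rintro rfl; exact tri _ _ _ hab hbw hq.symm
      have := hab.ne
      have := hp.ne
      have := hq.ne
      have := hbo.ne
      have := hbw.ne
      simp
      grind
    · rintro (rfl | rfl)
      exacts [hab.symm, hbo]
  refine ⟨a, h2, ?_⟩
  refine conn_ind G hc (fun v => v = a ∨ G.Adj a v ∨ ∃ b, G.Adj a b ∧ G.Adj b v) a (Or.inl rfl) ?_
  rintro x z (rfl | hx | ⟨b, hab, hbx⟩) hxz
  · exact Or.inr (Or.inl hxz)
  · exact Or.inr (Or.inr ⟨x, hx, hxz⟩)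
  by_cases hxa : x = a
  · subst hxa; exact Or.inr (Or.inl hxz)
  by_contra hz
  push Not at hz
  obtain ⟨hza, haz, hz2⟩ := hz
  have hax : ¬ G.Adj a x := fun h => hz2 x h hxz
  obtain ⟨o, hoa, ho⟩ := h2 b hab
  have hox : x = o := by
    rcases (ho x).1 hbx with h | h
    · exact absurd h hxa
    · exact h
  subst hox
  have nbr2 : ∀ v u, ∃ w, w ≠ u ∧ G.Adj v w := by
    intro v u
    obtain ⟨p, q, hpq, hp, hq⟩ := hd v
    by_cases h : p = u
    · exact ⟨q, fun h' => hpq (h.trans h'.symm), hq⟩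
    · exact ⟨p, h, hp⟩
  obtain ⟨y, hyx, hzy⟩ := nbr2 z x
  have hay : ¬ G.Adj a y := fun h => hz2 y h hzy.symm
  obtain ⟨w, hwz, hyw⟩ := nbr2 y z
  have hya : y ≠ a := by rintro rfl; exact haz hzy.symm
  have hyb : y ≠ b := by rintro rfl; exact hay hab
  have hzb : z ≠ b := by rintro rfl; exact haz hab
  have hxb := hbx.ne
  have hwx : w ≠ x := by rintro rfl; exact tri _ _ _ hxz hzy hyw
  have hwb : w ≠ b := by
    rintro rfl
    rcases (ho y).1 hyw.symm with h | h
    · exact hya h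
    · exact hyx h
  have hwa : w ≠ a := by rintro rfl; exact hay hyw.symm
  have hsub : ∀ b', G.Adj a b' → G.Adj x b' := by
    intro b' hab'
    by_cases hbb : b' = b
    · subst hbb; exact hbx.symm
    obtain ⟨x', hx'a, hx'⟩ := h2 b' hab'
    have hb'x' : G.Adj b' x' := (hx' x').2 (Or.inr rfl)
    by_cases hxx : x' = x
    · subst hxx; exact hb'x'.symm
    exfalso
    have e1 : b' ≠ x := by rintro rfl; exact hax hab'
    have e2 : b' ≠ z := by rintro rfl; exact haz hab'
    have e3 : b' ≠ y := by rintro rfl; exact hay hab'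
    have n1 := hab.ne
    have n2 := hab'.ne
    have n3 := hxz.ne
    have n4 := hzy.ne
    have n5 := hyw.ne
    have n6 := hb'x'.ne
    have e4 : b' ≠ w := by
      rintro rfl
      refine hC 6 (by norm_num) (by norm_num) (hasCyc_6 G b' a b x z y ?_ hab'.symm hab hbx hxz hzy hyw)
      simp
      grind
    have f1 : x' ≠ b := by rintro rfl; exact tri _ _ _ hab' hb'x' hab.symm
    have f2 : x' ≠ z := by
      rintro rfl
      exact hz2 _ hab' hb'x'
    have f3 : x' ≠ y := by
      rintro rfl
      refine hC 6 (by norm_num) (by norm_num) (hasCyc_6 G b' a b x z x' ?_ hab'.symm hab hbx hxz hzy hb'x'.symm)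
      simp
      grind
    have f4 : x' ≠ w := by
      rintro rfl
      refine hC 7 (by norm_num) (by norm_num) (hasCyc_7 G b' a b x z y x' ?_ hab'.symm hab hbx hxz hzy hyw hb'x'.symm)
      simp
      grind
    refine hP (hasP8 G x' b' a b x z y w ?_ hb'x'.symm hab'.symm hab hbx hxz hzy hyw)
    simp
    grind
  have hlt : (G.neighborSet a).ncard < (G.neighborSet x).ncard := by
    apply Set.ncard_lt_ncard _ (Set.toFinite _)
    refine ⟨fun b' hb' => hsub b' hb', fun h => haz (h hxz)⟩
  exact absurd (hmax x) (by simpa using hlt)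

theorem perf_of_struct [Fintype V] (G : SimpleGraph V)
    (hC : ∀ m : ℕ, 3 ≤ m → m ≠ 4 → ¬ containsSub (cycleG m) G) (a : V)
    (h2 : ∀ b, G.Adj a b → ∃ o, o ≠ a ∧ ∀ w, G.Adj b w ↔ w = a ∨ w = o)
    (h3 : ∀ v, v = a ∨ G.Adj a v ∨ ∃ b, G.Adj a b ∧ G.Adj b v)
    (S : Set V) (hS : MinDeg2 G S) : Perf G S := by
  classical
  have tri : ∀ x y z, G.Adj x y → G.Adj y z → G.Adj z x → False := fun x y z h1 h2 h3 =>
    hC 3 (by norm_num) (by norm_num) (hasCyc_3 G x y z h1 h2 h3)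
  choose! o hoa ho using h2
  -- neighbours of a far vertex are neighbours of a
  have far : ∀ x y, x ≠ a → ¬ G.Adj a x → G.Adj x y → G.Adj a y := by
    intro x y hxa hax hxy
    obtain rfl | h | ⟨b, hab, hby⟩ := h3 y
    · exact absurd hxy.symm hax
    · exact h
    obtain rfl | h | ⟨b', hab', hb'x⟩ := h3 x
    · exact absurd rfl hxa
    · exact absurd h hax
    exfalso
    have hya : y ≠ a := by rintro rfl; exact hax hxy.symm
    by_cases hbb : b = b'
    · subst hbb
      exact tri _ _ _ hby hxy.symm hb'x.symm
    refine hC 5 (by norm_num) (by norm_num) (hasCyc_5 G a b y x b' ?_ hab hby hxy.symm hb'x.symm hab'.symm)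
    have n1 := hab.ne
    have n2 := hab'.ne
    have n3 := hxy.ne
    have n4 := hby.ne
    have n5 := hb'x.ne
    have n6 : b ≠ x := by rintro rfl; exact hax hab
    have n7 : y ≠ b' := by rintro rfl; exact tri _ _ _ hab hby hab'.symm
    simp
    grind
  have hoadj : ∀ b, G.Adj a b → ¬ G.Adj a (o b) := by
    intro b hb h
    exact tri _ _ _ hb ((ho b hb _).2 (Or.inr rfl)) h.symm
  have inS : ∀ b ∈ S, G.Adj a b → a ∈ S ∧ o b ∈ S := by
    intro b hb hab
    obtain ⟨x, hx, y, hy, hxy, h1, h2⟩ := hS b hb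
    rw [ho b hab] at h1 h2
    grind
  have haS : ∀ v ∈ S, a ∈ S := by
    intro v hv
    by_cases hva : v = a
    · exact hva ▸ hv
    by_cases hav : G.Adj a v
    · exact (inS v hv hav).1
    obtain ⟨x, hx, y, hy, hxy, h1, h2⟩ := hS v hv
    exact (inS x hx (far v x hva hav h1)).1
  intro D hDS hD
  by_cases hne : S.Nonempty
  swap
  · rw [Set.not_nonempty_iff_eq_empty] at hne
    subst hne
    exact ⟨∅, by simp, by simp, by simp⟩
  obtain ⟨v0, hv0⟩ := hne
  have haS := haS v0 hv0
  refine ⟨{v | v ∈ S ∧ ¬ G.Adj a v}, fun v hv => hv.1, ?_, ?_⟩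
  swap
  · intro v hv hvD
    have hav : G.Adj a v := by
      by_contra h
      exact hvD ⟨hv, h⟩
    exact ⟨a, ⟨haS, G.loopless.irrefl a⟩, o v, ⟨(inS v hv hav).2, hoadj v hav⟩, (hoa v hav).symm,
      hav.symm, (ho v hav _).2 (Or.inr rfl)⟩
  have hb0 : ∃ b0 ∈ D, b0 = a ∨ (G.Adj a b0 ∧ a ∉ D) := by
    by_cases h : a ∈ D
    · exact ⟨a, h, Or.inl rfl⟩
    · obtain ⟨x, hx, hax⟩ := hD a haS h
      exact ⟨x, hx, Or.inr ⟨hax, h⟩⟩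
  obtain ⟨b0, hb0D, hb0⟩ := hb0
  let f : V → V := fun w => if w = b0 then a else if G.Adj a w then o w else w
  refine le_trans (Set.ncard_le_ncard (t := f '' D) ?_ (Set.toFinite _))
    (Set.ncard_image_le (Set.toFinite _))
  rintro x ⟨hxS, hax⟩
  by_cases hxa : x = a
  · subst hxa
    exact ⟨b0, hb0D, by simp [f]⟩
  have hxb0 : x ≠ b0 := by
    rintro rfl
    rcases hb0 with h | h
    · exact hxa h
    · exact hax h.1
  by_cases hxD : x ∈ D
  · exact ⟨x, hxD, by simp [f, hxb0, hax]⟩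
  have hit : ∀ b ∈ D, b ≠ b0 → G.Adj x b → x ∈ f '' D := by
    intro b hbD hb hxb
    have hab := far x b hxa hax hxb
    refine ⟨b, hbD, ?_⟩
    have : x = o b := by
      rcases (ho b hab x).1 hxb.symm with h | h
      · exact absurd h hxa
      · exact h
    simp [f, hb, hab, this]
  obtain ⟨b, hbD, hxb⟩ := hD x hxS hxD
  by_cases hb : b = b0
  swap
  · exact hit b hbD hb hxb
  subst hb
  have hab := far x b hxa hax hxb
  have haD : a ∉ D := by
    rcases hb0 with h | h
    · exact absurd h hab.ne'
    · exact h.2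
  have : ∃ b' ∈ S, b' ≠ b ∧ G.Adj x b' := by
    obtain ⟨p, hp, q, hq, hpq, h1, h2⟩ := hS x hxS
    by_cases h : p = b
    · exact ⟨q, hq, fun h' => hpq (h.trans h'.symm), h2⟩
    · exact ⟨p, hp, h, h1⟩
  obtain ⟨b', hb'S, hb'b, hxb'⟩ := this
  by_cases hb'D : b' ∈ D
  · exact hit b' hb'D hb'b hxb'
  exfalso
  obtain ⟨d, hd, hbd⟩ := hD b' hb'S hb'D
  have hab' := far x b' hxa hax hxb'
  rw [ho b' hab'] at hbd
  have hx' := (ho b' hab' x).1 hxb'.symm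
  grind

theorem hasCyc3_of (G : SimpleGraph V) (a b c : V) (h1 : G.Adj a b) (h2 : G.Adj b c)
    (h3 : G.Adj c a) : HasCyc G 3 := hasCyc_of G 3 le_rfl (hasCyc_3 G a b c h1 h2 h3)

theorem no_cyc [Fintype V] (G : SimpleGraph V) (perf : ∀ S : Set V, MinDeg2 G S → Perf G S)
    (m : ℕ) : 3 ≤ m → m ≠ 4 → ¬ HasCyc G m := by
  classical
  induction m using Nat.strong_induction_on with
  | _ m IH =>
  intro hm hm4 ⟨c, hinj, hadj, hlast⟩
  -- successor index
  have hm0 : 0 < m := by omega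
  let nx : ℕ → ℕ := fun i => if i + 1 = m then 0 else i + 1
  have nx_lt : ∀ i < m, nx i < m := by
    intro i hi; simp only [nx]; split_ifs <;> omega
  have adj_nx : ∀ i < m, G.Adj (c i) (c (nx i)) := by
    intro i hi
    simp only [nx]
    split_ifs with h
    · have : i = m - 1 := by omega
      rw [this]; exact hlast
    · exact hadj i (by omega)
  have nx_sur : ∀ i < m, ∃ j < m, nx j = i := by
    intro i hi
    by_cases h : i = 0
    · exact ⟨m - 1, by omega, by simp only [nx]; split_ifs <;> omega⟩
    · exact ⟨i - 1, by omega, by simp only [nx]; split_ifs <;> omega⟩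
  -- chords force m = 6
  have chord : m = 6 ∨ ∀ i < m, ∀ j < m, G.Adj (c i) (c j) → j = nx i ∨ i = nx j := by
    by_contra hcon
    push Not at hcon
    obtain ⟨h6, i, hi, j, hj, hij, h1, h2⟩ := hcon
    have wlog : ∀ i j, i < j → j < m → G.Adj (c i) (c j) → j ≠ nx i → i ≠ nx j → False := by
      intro i j hlt hj hij h1 h2
      have g1 : i + 1 < j := by
        simp only [nx] at h1 h2
        split_ifs at h1 h2 <;> omega
      have g2 : j - i + 1 < m := by
        simp only [nx] at h1 h2
        split_ifs at h1 h2 <;> omega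
      have c1 : HasCyc G (j - i + 1) := by
        refine ⟨fun k => c (i + k), ?_, ?_, ?_⟩
        · intro k hk l hl h
          have := hinj _ (by omega) _ (by omega) h
          omega
        · intro k hk
          exact hadj (i + k) (by omega)
        · have : i + (j - i + 1 - 1) = j := by omega
          simp only [this, add_zero]
          exact hij.symm
      have c2 : HasCyc G (m - (j - i) + 1) := by
        refine ⟨fun k => if k ≤ i then c k else c (k + (j - i - 1)), ?_, ?_, ?_⟩
        · intro k hk l hl h
          simp only at h
          split_ifs at h <;> have := hinj _ (by omega) _ (by omega) h <;> omega
        · intro k hk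
          simp only
          by_cases hk1 : k + 1 ≤ i
          · rw [if_pos (by omega), if_pos hk1]
            exact hadj k (by omega)
          · by_cases hk2 : k = i
            · subst hk2
              rw [if_pos le_rfl, if_neg hk1]
              have : k + 1 + (j - k - 1) = j := by omega
              rw [this]; exact hij
            · rw [if_neg (by omega), if_neg hk1]
              have : k + 1 + (j - i - 1) = k + (j - i - 1) + 1 := by omega
              rw [this]
              exact hadj _ (by omega)
        · simp only [zero_le, if_true]
          rw [if_neg (by omega)]
          have : m - (j - i) + 1 - 1 + (j - i - 1) = m - 1 := by omega
          rw [this]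
          exact hlast
      have e1 : j - i + 1 = 4 := by
        by_contra h
        exact IH _ g2 (by omega) h c1
      have e2 : m - (j - i) + 1 = 4 := by
        by_contra h
        exact IH _ (by omega) (by omega) h c2
      omega
    rcases lt_trichotomy i j with h | h | h
    · exact wlog i j h hj hij h1 h2
    · subst h; exact G.loopless.irrefl _ hij
    · exact wlog j i h hi hij.symm h2 h1
  let S : Set V := c '' {i | i < m}
  have hS : MinDeg2 G S := by
    rintro _ ⟨i, hi, rfl⟩
    obtain ⟨j, hj, rfl⟩ := nx_sur i hi
    refine ⟨c j, ⟨j, hj, rfl⟩, c (nx (nx j)), ⟨_, nx_lt _ hi, rfl⟩, ?_, (adj_nx j hj).symm,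
      adj_nx _ hi⟩
    intro h
    have := hinj _ hj _ (nx_lt _ hi) h
    simp only [nx] at this
    split_ifs at this <;> omega
  let D : Set V := c '' ↑((Finset.range ((m + 2) / 3)).image (fun k => 3 * k))
  have hDc : D.ncard ≤ (m + 2) / 3 := by
    refine le_trans (Set.ncard_image_le (Set.toFinite _)) ?_
    rw [Set.ncard_coe_finset]
    exact le_trans Finset.card_image_le (by simp)
  have hDm : ∀ k, 3 * k < m → c (3 * k) ∈ D := by
    intro k hk
    refine ⟨3 * k, ?_, rfl⟩
    simp only [Finset.coe_image, Set.mem_image, Finset.coe_range, Set.mem_Iio]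
    exact ⟨k, by omega, rfl⟩
  have hDS : D ⊆ S := by
    rintro _ ⟨i, hi, rfl⟩
    simp only [Finset.coe_image, Set.mem_image, Finset.coe_range, Set.mem_Iio] at hi
    obtain ⟨k, hk, rfl⟩ := hi
    exact ⟨3 * k, show 3 * k < m by omega, rfl⟩
  have hD : ∀ v ∈ S, v ∉ D → ∃ x ∈ D, G.Adj v x := by
    rintro _ ⟨i, hi, rfl⟩ hiD
    change i < m at hi
    have : i % 3 = 0 ∨ i % 3 = 1 ∨ i % 3 = 2 := by omega
    rcases this with h | h | h
    · exfalso
      apply hiD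
      have : i = 3 * (i / 3) := by omega
      rw [this]
      exact hDm _ (by omega)
    · refine ⟨c (3 * (i / 3)), hDm _ (by omega), ?_⟩
      have : i = 3 * (i / 3) + 1 := by omega
      have h' := hadj (3 * (i / 3)) (by omega)
      rw [← this] at h'
      exact h'.symm
    · by_cases hl : i + 1 = m
      · refine ⟨c (3 * 0), hDm _ (by omega), ?_⟩
        have : i = m - 1 := by omega
        rw [this]; exact hlast
      · refine ⟨c (3 * (i / 3 + 1)), hDm _ (by omega), ?_⟩
        have : i + 1 = 3 * (i / 3 + 1) := by omega
        rw [← this]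
        exact hadj i (by omega)
  obtain ⟨D', hD'S, hD'c, hD'⟩ := perf S hS D hDS hD
  have cover : ∀ i < m, c i ∈ D' ∨ c (nx i) ∈ D' := by
    intro i hi
    by_contra hcon
    push Not at hcon
    obtain ⟨hi1, hi2⟩ := hcon
    obtain ⟨x, hx, y, hy, hxy, hax, hay⟩ := hD' _ ⟨i, hi, rfl⟩ hi1
    by_cases h6 : m = 6
    · have hle : D'.ncard ≤ 2 := by
        refine le_trans hD'c (le_trans hDc ?_)
        omega
      obtain ⟨x', hx', y', hy', hxy', hax', hay'⟩ := hD' _ ⟨nx i, nx_lt i hi, rfl⟩ hi2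
      have hsub : ({x, y} : Set V) ⊆ D' := by
        rintro z (rfl | rfl) <;> assumption
      have heq : ({x, y} : Set V) = D' := by
        apply Set.eq_of_subset_of_ncard_le hsub _ (Set.toFinite _)
        rw [Set.ncard_pair hxy]
        exact hle
      rw [← heq] at hx'
      have h3 : HasCyc G 3 := by
        rcases hx' with rfl | rfl
        · exact hasCyc3_of G _ _ _ (adj_nx i hi) hax' hax.symm
        · exact hasCyc3_of G _ _ _ (adj_nx i hi) hax' hay.symm
      exact IH 3 (by omega) (by omega) (by omega) h3
    · have hch := chord.resolve_left h6
      obtain ⟨p, hp, rfl⟩ := hD'S hx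
      obtain ⟨q, hq, rfl⟩ := hD'S hy
      have h1 := hch i hi p hp hax
      have h2 := hch i hi q hq hay
      have n1 : p ≠ nx i := by rintro rfl; exact hi2 hx
      have n2 : q ≠ nx i := by rintro rfl; exact hi2 hy
      have h1 := h1.resolve_left n1
      have h2 := h2.resolve_left n2
      apply hxy
      congr 1
      change p < m at hp
      change q < m at hq
      rw [h1] at h2
      simp only [nx] at h2
      split_ifs at h2 <;> omega
  let I : Finset ℕ := (Finset.range m).filter (fun i => c i ∈ D')
  have hI : I.card ≤ D'.ncard := by
    rw [← Set.ncard_coe_finset]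
    apply Set.ncard_le_ncard_of_injOn c _ _ (Set.toFinite _)
    · intro i hi
      simp [I] at hi
      exact hi.2
    · intro i hi j hj h
      simp [I] at hi hj
      exact hinj i hi.1 j hj.1 h
  have hcov : Finset.range m ⊆ I ∪ I.image (fun i => if i = 0 then m - 1 else i - 1) := by
    intro i hi
    rw [Finset.mem_range] at hi
    rw [Finset.mem_union]
    rcases cover i hi with h | h
    · left; simp [I, hi, h]
    · right
      rw [Finset.mem_image]
      refine ⟨nx i, by simp [I, nx_lt i hi, h], ?_⟩
      by_cases h' : i + 1 = m
      · simp [nx, h']; omega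
      · simp [nx, h']
  have h1 := Finset.card_le_card hcov
  have h2 := Finset.card_union_le I (I.image (fun i => if i = 0 then m - 1 else i - 1))
  have h3 : (I.image (fun i => if i = 0 then m - 1 else i - 1)).card ≤ I.card :=
    Finset.card_image_le
  rw [Finset.card_range] at h1
  omega

theorem or_help {p q r s : Prop} (h1 : ¬ p → r ∧ s) (h2 : ¬ q → r ∧ s) : (p ∧ q) ∨ (r ∧ s) := by
  tauto

theorem or_help' {p q r s : Prop} (h1 : ¬ r → p ∧ q) (h2 : ¬ s → p ∧ q) : (p ∧ q) ∨ (r ∧ s) := by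
  tauto

theorem four [Fintype V] (E : Set V) {p q r s : V} (hp : p ∈ E) (hq : q ∈ E) (hr : r ∈ E)
    (hs : s ∈ E) (h1 : p ≠ q) (h2 : p ≠ r) (h3 : p ≠ s) (h4 : q ≠ r) (h5 : q ≠ s) (h6 : r ≠ s) :
    4 ≤ E.ncard := by
  classical
  have : (({p, q, r, s} : Finset V) : Set V).ncard ≤ E.ncard := by
    apply Set.ncard_le_ncard _ (Set.toFinite _)
    intro x hx
    simp at hx
    rcases hx with rfl | rfl | rfl | rfl <;> assumption
  rw [Set.ncard_coe_finset] at this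
  have e : ({p, q, r, s} : Finset V).card = 4 := by
    rw [Finset.card_insert_of_notMem, Finset.card_insert_of_notMem, Finset.card_pair h6] <;>
      simp [*]
  omega


set_option maxHeartbeats 1000000 in
theorem dstruct [Fintype V] (G : SimpleGraph V) (perf : ∀ S : Set V, MinDeg2 G S → Perf G S)
    (hd : ∀ v, ∃ x y, x ≠ y ∧ G.Adj v x ∧ G.Adj v y)
    (hC : ∀ m : ℕ, 3 ≤ m → m ≠ 4 → ¬ containsSub (cycleG m) G) :
    ∃ D : Set V, (∀ x ∈ D, ∀ y ∈ D, ¬ G.Adj x y) ∧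
      (∀ u ∉ D, ∀ w ∉ D, ¬ G.Adj u w) ∧
      (∀ u ∉ D, ∃ x ∈ D, ∃ y ∈ D, x ≠ y ∧ ∀ w, G.Adj u w ↔ w = x ∨ w = y) ∧
      (∀ u ∉ D, ∃ u' ∉ D, u' ≠ u ∧ ∀ w, G.Adj u w ↔ G.Adj u' w) := by
  classical
  have tri : ∀ x y z, G.Adj x y → G.Adj y z → G.Adj z x → False := fun x y z h1 h2 h3 =>
    hC 3 (by norm_num) (by norm_num) (hasCyc_3 G x y z h1 h2 h3)
  have huniv : MinDeg2 G Set.univ := by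
    intro v _
    obtain ⟨x, y, h⟩ := hd v
    exact ⟨x, trivial, y, trivial, h⟩
  have hmin : ∃ D : Set V, (∀ v ∉ D, ∃ x ∈ D, G.Adj v x) ∧
      ∀ E : Set V, (∀ v ∉ E, ∃ x ∈ E, G.Adj v x) → D.ncard ≤ E.ncard := by
    obtain ⟨D, hD, hm⟩ := Set.exists_min_image {D : Set V | ∀ v ∉ D, ∃ x ∈ D, G.Adj v x}
      Set.ncard (Set.toFinite _) ⟨Set.univ, fun v hv => absurd trivial hv⟩
    exact ⟨D, hD, hm⟩
  obtain ⟨D0, hD0, hmin0⟩ := hmin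
  obtain ⟨D, -, hDc, hD2⟩ := perf _ huniv D0 (Set.subset_univ _) (fun v _ => hD0 v)
  have hD2 : ∀ v ∉ D, ∃ x ∈ D, ∃ y ∈ D, x ≠ y ∧ G.Adj v x ∧ G.Adj v y := fun v => hD2 v trivial
  have hmin : ∀ E : Set V, (∀ v ∉ E, ∃ x ∈ E, G.Adj v x) → D.ncard ≤ E.ncard :=
    fun E hE => hDc.trans (hmin0 E hE)
  have ind : ∀ x ∈ D, ∀ y ∈ D, ¬ G.Adj x y := by
    intro x hx y hy hxy
    have := hmin (D \ {x}) (by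
      intro v hv
      by_cases hvx : v = x
      · subst hvx
        exact ⟨y, ⟨hy, hxy.ne'⟩, hxy⟩
      · have hvD : v ∉ D := fun h => hv ⟨h, hvx⟩
        obtain ⟨p, hp, q, hq, hpq, h1, h2⟩ := hD2 v hvD
        by_cases h : p = x
        · exact ⟨q, ⟨hq, fun h' => hpq (h.trans h'.symm)⟩, h2⟩
        · exact ⟨p, ⟨hp, h⟩, h1⟩)
    have h2 := Set.ncard_sdiff_singleton_lt_of_mem hx (Set.toFinite _)
    omega
  -- twin
  have twin : ∀ u ∉ D, ∀ x ∈ D, ∀ y ∈ D, x ≠ y → G.Adj u x → G.Adj u y →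
      ∃ u' ∉ D, u' ≠ u ∧ ∀ w ∈ D, G.Adj u' w ↔ w = x ∨ w = y := by
    intro u hu x hx y hy hxy hux huy
    by_contra hcon
    push Not at hcon
    have := hmin (insert u ((D \ {x}) \ {y})) (by
      intro v hv
      rw [Set.mem_insert_iff, not_or] at hv
      obtain ⟨hvu, hv⟩ := hv
      by_cases hvx : v = x
      · exact ⟨u, Set.mem_insert _ _, hvx ▸ hux.symm⟩
      by_cases hvy : v = y
      · exact ⟨u, Set.mem_insert _ _, hvy ▸ huy.symm⟩
      have hvD : v ∉ D := fun h => hv ⟨⟨h, hvx⟩, hvy⟩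
      obtain ⟨w, hw, hw'⟩ := hcon v hvD hvu
      obtain ⟨p, hp, q, hq, hpq, h1, h2⟩ := hD2 v hvD
      have : ∃ r ∈ D, r ≠ x ∧ r ≠ y ∧ G.Adj v r := by grind
      obtain ⟨r, hr, h3, h4, h5⟩ := this
      exact ⟨r, Or.inr ⟨⟨hr, h3⟩, h4⟩, h5⟩)
    have h2 := Set.ncard_insert_le u ((D \ {x}) \ {y})
    have h3 : y ∈ D \ {x} := ⟨hy, hxy.symm⟩
    have h4 := Set.ncard_sdiff_singleton_lt_of_mem hx (Set.toFinite _)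
    have h5 := Set.ncard_sdiff_singleton_lt_of_mem h3 (Set.toFinite _)
    omega
  have ex2 : ∀ u ∉ D, ∃ x ∈ D, ∃ y ∈ D, x ≠ y ∧ ∀ w ∈ D, G.Adj u w ↔ w = x ∨ w = y := by
    intro u hu
    obtain ⟨x, hx, y, hy, hxy, hux, huy⟩ := hD2 u hu
    refine ⟨x, hx, y, hy, hxy, fun z hz => ⟨fun huz => ?_, ?_⟩⟩
    swap
    · rintro (rfl | rfl) <;> assumption
    by_contra hcon
    push Not at hcon
    obtain ⟨hzx, hzy⟩ := hcon
    obtain ⟨p, hp, -, hp'⟩ := twin u hu x hx y hy hxy hux huy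
    obtain ⟨q, hq, -, hq'⟩ := twin u hu y hy z hz hzy.symm huy huz
    obtain ⟨r, hr, -, hr'⟩ := twin u hu z hz x hx hzx huz hux
    refine hC 6 (by norm_num) (by norm_num) (hasCyc_6 G x p y q z r ?_ ((hp' x hx).2 (Or.inl rfl)).symm
      ((hp' y hy).2 (Or.inr rfl)) ((hq' y hy).2 (Or.inl rfl)).symm
      ((hq' z hz).2 (Or.inr rfl)) ((hr' z hz).2 (Or.inl rfl)).symm
      ((hr' x hx).2 (Or.inr rfl)))
    have n1 : p ≠ q := by
      rintro rfl
      have := (hp' z hz).1 ((hq' z hz).2 (Or.inr rfl))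
      grind
    have n2 : p ≠ r := by
      rintro rfl
      have := (hp' z hz).1 ((hr' z hz).2 (Or.inl rfl))
      grind
    have n3 : q ≠ r := by
      rintro rfl
      have := (hq' x hx).1 ((hr' x hx).2 (Or.inr rfl))
      grind
    simp
    grind
  have indU : ∀ u ∉ D, ∀ w ∉ D, ¬ G.Adj u w := by
    intro u hu u2 hu2 huu
    obtain ⟨v, hv, w, hw, hvw, h1⟩ := ex2 u hu
    obtain ⟨x, hx, y, hy, hxy, h2⟩ := ex2 u2 hu2
    have huv := (h1 v hv).2 (Or.inl rfl)
    have huw := (h1 w hw).2 (Or.inr rfl)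
    have hux := (h2 x hx).2 (Or.inl rfl)
    have huy := (h2 y hy).2 (Or.inr rfl)
    obtain ⟨u', hu', huu', h1'⟩ := twin u hu v hv w hw hvw huv huw
    obtain ⟨u2', hu2', huu2', h2'⟩ := twin u2 hu2 x hx y hy hxy hux huy
    have huv' := (h1' v hv).2 (Or.inl rfl)
    have huw' := (h1' w hw).2 (Or.inr rfl)
    have hux' := (h2' x hx).2 (Or.inl rfl)
    have huy' := (h2' y hy).2 (Or.inr rfl)
    have nvx : v ≠ x := by rintro rfl; exact tri _ _ _ huu hux huv.symm
    have nvy : v ≠ y := by rintro rfl; exact tri _ _ _ huu huy huv.symm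
    have nwx : w ≠ x := by rintro rfl; exact tri _ _ _ huu hux huw.symm
    have nwy : w ≠ y := by rintro rfl; exact tri _ _ _ huu huy huw.symm
    let S : Set V := {v, w, u, u', x, y, u2, u2'}
    have hS : MinDeg2 G S := by
      rintro z (rfl | rfl | rfl | rfl | rfl | rfl | rfl | rfl)
      · exact ⟨u, by simp [S], u', by simp [S], huu'.symm, huv.symm, huv'.symm⟩
      · exact ⟨u, by simp [S], u', by simp [S], huu'.symm, huw.symm, huw'.symm⟩
      · exact ⟨v, by simp [S], w, by simp [S], hvw, huv, huw⟩
      · exact ⟨v, by simp [S], w, by simp [S], hvw, huv', huw'⟩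
      · exact ⟨u2, by simp [S], u2', by simp [S], huu2'.symm, hux.symm, hux'.symm⟩
      · exact ⟨u2, by simp [S], u2', by simp [S], huu2'.symm, huy.symm, huy'.symm⟩
      · exact ⟨x, by simp [S], y, by simp [S], hxy, hux, huy⟩
      · exact ⟨x, by simp [S], y, by simp [S], hxy, hux', huy'⟩
    obtain ⟨E, hES, hEc, hE⟩ := perf S hS {v, u, u2'} (by
        rintro z (rfl | rfl | rfl) <;> simp [S]) (by
      rintro z (rfl | rfl | rfl | rfl | rfl | rfl | rfl | rfl) hz
      · simp at hz
      · exact ⟨u, by simp, huw.symm⟩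
      · simp at hz
      · exact ⟨v, by simp, huv'⟩
      · exact ⟨u2', by simp, hux'.symm⟩
      · exact ⟨u2', by simp, huy'.symm⟩
      · exact ⟨u, by simp, huu.symm⟩
      · simp at hz)
    have hE3 : E.ncard ≤ 3 := hEc.trans (by
      have := Set.ncard_insert_le v {u, u2'}
      have := Set.ncard_insert_le u {u2'}
      have := Set.ncard_singleton u2'
      omega)
    have key : ∀ z ∈ S, z ∉ E → ∀ p q, (∀ t ∈ S, G.Adj z t → t = p ∨ t = q) → p ∈ E ∧ q ∈ E := by
      intro z hz hzE p q hpq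
      obtain ⟨s, hs, t, ht, hst, h1, h2⟩ := hE z hz hzE
      have := hpq s (hES hs) h1
      have := hpq t (hES ht) h2
      grind
    have k1 : ∀ z ∈ D, z ≠ x → z ≠ y → z ∈ S → z ∉ E → u ∈ E ∧ u' ∈ E := by
      intro z hzD hzx hzy hzS hzE
      refine key z hzS hzE u u' ?_
      intro t ht hzt
      rcases ht with h | h | h | h | h | h | h | h
      · exact absurd hzt (ind z hzD t (h ▸ hv))
      · exact absurd hzt (ind z hzD t (h ▸ hw))
      · exact Or.inl h
      · exact Or.inr h
      · exact absurd hzt (ind z hzD t (h ▸ hx))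
      · exact absurd hzt (ind z hzD t (h ▸ hy))
      · rw [h] at hzt
        rcases (h2 z hzD).1 hzt.symm with h | h <;> contradiction
      · rw [h] at hzt
        rcases (h2' z hzD).1 hzt.symm with h | h <;> contradiction
    have k2 : ∀ z ∈ D, z ≠ v → z ≠ w → z ∈ S → z ∉ E → u2 ∈ E ∧ u2' ∈ E := by
      intro z hzD hzx hzy hzS hzE
      refine key z hzS hzE u2 u2' ?_
      intro t ht hzt
      rcases ht with h | h | h | h | h | h | h | h
      · exact absurd hzt (ind z hzD t (h ▸ hv))
      · exact absurd hzt (ind z hzD t (h ▸ hw))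
      · rw [h] at hzt
        rcases (h1 z hzD).1 hzt.symm with h | h <;> contradiction
      · rw [h] at hzt
        rcases (h1' z hzD).1 hzt.symm with h | h <;> contradiction
      · exact absurd hzt (ind z hzD t (h ▸ hx))
      · exact absurd hzt (ind z hzD t (h ▸ hy))
      · exact Or.inl h
      · exact Or.inr h
    have kv := k1 v hv nvx nvy (by simp [S])
    have kw := k1 w hw nwx nwy (by simp [S])
    have kx := k2 x hx nvx.symm nwx.symm (by simp [S])
    have ky := k2 y hy nvy.symm nwy.symm (by simp [S])
    have n1 : u ≠ u2' := by rintro rfl; exact tri _ _ _ huu hux hux'.symm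
    have n2 : u' ≠ u2 := by rintro rfl; exact tri _ _ _ huu huv' huv.symm
    have n3 : u' ≠ u2' := by
      rintro rfl
      rcases (h2' v hv).1 huv' with h | h <;> contradiction
    have n4 := huu.ne
    have nDU : ∀ p ∈ D, ∀ q ∉ D, p ≠ q := fun p hp q hq h => hq (h ▸ hp)
    have c1 : (v ∈ E ∧ w ∈ E) ∨ (u ∈ E ∧ u' ∈ E) := or_help kv kw
    have c2 : (x ∈ E ∧ y ∈ E) ∨ (u2 ∈ E ∧ u2' ∈ E) := or_help kx ky
    have h4 : 4 ≤ E.ncard := by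
      rcases c1 with ⟨p, q⟩ | ⟨p, q⟩ <;> rcases c2 with ⟨r, s⟩ | ⟨r, s⟩
      · exact four E p q r s hvw nvx nvy nwx nwy hxy
      · exact four E p q r s hvw (nDU _ hv _ hu2) (nDU _ hv _ hu2') (nDU _ hw _ hu2)
          (nDU _ hw _ hu2') huu2'.symm
      · exact four E p q r s huu'.symm (nDU _ hx _ hu).symm (nDU _ hy _ hu).symm
          (nDU _ hx _ hu').symm (nDU _ hy _ hu').symm hxy
      · exact four E p q r s huu'.symm n4 n1 n2 n3 huu2'.symm
    omega
  refine ⟨D, ind, indU, ?_, ?_⟩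
  · intro u hu
    obtain ⟨x, hx, y, hy, hxy, h⟩ := ex2 u hu
    refine ⟨x, hx, y, hy, hxy, fun w => ?_⟩
    by_cases hw : w ∈ D
    · exact h w hw
    · have := indU u hu w hw
      grind
  · intro u hu
    obtain ⟨x, hx, y, hy, hxy, h⟩ := ex2 u hu
    obtain ⟨u', hu', hne, h'⟩ := twin u hu x hx y hy hxy ((h x hx).2 (Or.inl rfl)) ((h y hy).2 (Or.inr rfl))
    refine ⟨u', hu', hne, fun w => ?_⟩
    by_cases hw : w ∈ D
    · rw [h w hw, h' w hw]
    · have := indU u hu w hw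
      have := indU u' hu' w hw
      tauto

theorem no_T6 (G : SimpleGraph V) (D : Set V) (hD : ∀ x ∈ D, ∀ y ∈ D, ¬ G.Adj x y)
    (h2 : ∀ u ∉ D, ∃ x ∈ D, ∃ y ∈ D, x ≠ y ∧ ∀ w, G.Adj u w ↔ w = x ∨ w = y) :
    ¬ containsSub T6 G := by
  rintro ⟨φ, hinj, hadj⟩
  have no3 : ∀ u ∉ D, ∀ a b c, a ≠ b → a ≠ c → b ≠ c → G.Adj u a → G.Adj u b → G.Adj u c → False := by
    intro u hu a b c h1 h3 h4 h5 h6 h7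
    obtain ⟨x, _, y, _, _, h⟩ := h2 u hu
    rw [h] at h5 h6 h7
    grind
  have e01 : G.Adj (φ 0) (φ 1) := hadj _ _ (by simp [T6])
  have e02 : G.Adj (φ 0) (φ 2) := hadj _ _ (by simp [T6])
  have e03 : G.Adj (φ 0) (φ 3) := hadj _ _ (by simp [T6])
  have e14 : G.Adj (φ 1) (φ 4) := hadj _ _ (by simp [T6])
  have e15 : G.Adj (φ 1) (φ 5) := hadj _ _ (by simp [T6])
  by_cases h0 : φ 0 ∈ D
  · by_cases h1 : φ 1 ∈ D
    · exact hD _ h0 _ h1 e01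
    · exact no3 _ h1 (φ 0) (φ 4) (φ 5) (hinj.ne (by decide)) (hinj.ne (by decide))
        (hinj.ne (by decide)) e01.symm e14 e15
  · exact no3 _ h0 (φ 1) (φ 2) (φ 3) (hinj.ne (by decide)) (hinj.ne (by decide))
        (hinj.ne (by decide)) e01 e02 e03

theorem no_P7 [Fintype V] (G : SimpleGraph V) (perf : ∀ S : Set V, MinDeg2 G S → Perf G S)
    (D : Set V) (hD : ∀ x ∈ D, ∀ y ∈ D, ¬ G.Adj x y)
    (h2 : ∀ u ∉ D, ∃ x ∈ D, ∃ y ∈ D, x ≠ y ∧ ∀ w, G.Adj u w ↔ w = x ∨ w = y)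
    (htw : ∀ u ∉ D, ∃ u' ∉ D, u' ≠ u ∧ ∀ w, G.Adj u w ↔ G.Adj u' w)
    (p0 p1 p2 p3 p4 p5 p6 : V) (hn : [p0, p2, p4, p6].Nodup)
    (d0 : p0 ∈ D) (d2 : p2 ∈ D) (d4 : p4 ∈ D) (d6 : p6 ∈ D)
    (e1 : G.Adj p0 p1) (e2 : G.Adj p1 p2) (e3 : G.Adj p2 p3) (e4 : G.Adj p3 p4)
    (e5 : G.Adj p4 p5) (e6 : G.Adj p5 p6) : False := by
  have u1 : p1 ∉ D := fun h => hD _ d0 _ h e1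
  have u3 : p3 ∉ D := fun h => hD _ d2 _ h e3
  have u5 : p5 ∉ D := fun h => hD _ d4 _ h e5
  obtain ⟨q1, v1, n1, t1⟩ := htw p1 u1
  obtain ⟨q5, v5, n5, t5⟩ := htw p5 u5
  simp only [List.nodup_cons, List.mem_cons, List.not_mem_nil, or_false, not_or,
    List.nodup_nil, and_true, not_false_eq_true] at hn
  obtain ⟨⟨n02, n04, n06⟩, ⟨n24, n26⟩, n46⟩ := hn
  have a1 : ∀ w, G.Adj p1 w → w = p0 ∨ w = p2 := by
    intro w hw
    obtain ⟨x, _, y, _, _, h⟩ := h2 p1 u1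
    have f1 := (h _).1 e1.symm
    have f2 := (h _).1 e2
    have f3 := (h _).1 hw
    grind
  have a5 : ∀ w, G.Adj p5 w → w = p4 ∨ w = p6 := by
    intro w hw
    obtain ⟨x, _, y, _, _, h⟩ := h2 p5 u5
    have f1 := (h _).1 e5.symm
    have f2 := (h _).1 e6
    have f3 := (h _).1 hw
    grind
  have b1 := (t1 _).1 e1.symm
  have b2 := (t1 _).1 e2
  have b5 := (t5 _).1 e5.symm
  have b6 := (t5 _).1 e6
  let S : Set V := {p0, p1, q1, p2, p3, p4, p5, q5, p6}
  have hS : MinDeg2 G S := by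
    rintro z (rfl | rfl | rfl | rfl | rfl | rfl | rfl | rfl | rfl)
    · exact ⟨p1, by simp [S], q1, by simp [S], n1.symm, e1, b1.symm⟩
    · exact ⟨p0, by simp [S], p2, by simp [S], n02, e1.symm, e2⟩
    · exact ⟨p0, by simp [S], p2, by simp [S], n02, b1, b2⟩
    · exact ⟨p1, by simp [S], q1, by simp [S], n1.symm, e2.symm, b2.symm⟩
    · exact ⟨p2, by simp [S], p4, by simp [S], n24, e3.symm, e4⟩
    · exact ⟨p5, by simp [S], q5, by simp [S], n5.symm, e5, b5.symm⟩
    · exact ⟨p4, by simp [S], p6, by simp [S], n46, e5.symm, e6⟩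
    · exact ⟨p4, by simp [S], p6, by simp [S], n46, b5, b6⟩
    · exact ⟨p5, by simp [S], q5, by simp [S], n5.symm, e6.symm, b6.symm⟩
  obtain ⟨E, hES, hEc, hE⟩ := perf S hS {p0, p3, p6} (by
      rintro z (rfl | rfl | rfl) <;> simp [S]) (by
    rintro z (rfl | rfl | rfl | rfl | rfl | rfl | rfl | rfl | rfl) hz
    · simp at hz
    · exact ⟨p0, by simp, e1.symm⟩
    · exact ⟨p0, by simp, b1⟩
    · exact ⟨p3, by simp, e3⟩
    · simp at hz
    · exact ⟨p3, by simp, e4.symm⟩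
    · exact ⟨p6, by simp, e6⟩
    · exact ⟨p6, by simp, b6⟩
    · simp at hz)
  have hE3 : E.ncard ≤ 3 := hEc.trans (by
    have := Set.ncard_insert_le p0 {p3, p6}
    have := Set.ncard_insert_le p3 {p6}
    have := Set.ncard_singleton p6
    omega)
  have key : ∀ z ∈ S, z ∉ E → ∀ p q, (∀ t, G.Adj z t → t = p ∨ t = q) → p ∈ E ∧ q ∈ E := by
    intro z hz hzE p q hpq
    obtain ⟨s, hs, t, ht, hst, h1, h2⟩ := hE z hz hzE
    have := hpq s h1
    have := hpq t h2
    grind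
  have k1 := fun h => key p1 (by simp [S]) h p0 p2 a1
  have k2 := fun h => key q1 (by simp [S]) h p0 p2 (fun t ht => a1 t ((t1 t).2 ht))
  have k3 := fun h => key p5 (by simp [S]) h p4 p6 a5
  have k4 := fun h => key q5 (by simp [S]) h p4 p6 (fun t ht => a5 t ((t5 t).2 ht))
  have nDU : ∀ p ∈ D, ∀ q ∉ D, p ≠ q := fun p hp q hq h => hq (h ▸ hp)
  have c1 : (p0 ∈ E ∧ p2 ∈ E) ∨ (p1 ∈ E ∧ q1 ∈ E) := or_help' k1 k2
  have c2 : (p4 ∈ E ∧ p6 ∈ E) ∨ (p5 ∈ E ∧ q5 ∈ E) := or_help' k3 k4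
  have dj : ∀ z, G.Adj z p0 → (∀ t, G.Adj z t → t = p4 ∨ t = p6) → False := by
    intro z h1 h2
    rcases h2 _ h1 with h | h <;> contradiction
  have m1 : p1 ≠ p5 := fun h => dj p1 e1.symm (h ▸ a5)
  have m2 : p1 ≠ q5 := fun h => dj p1 e1.symm (fun t ht => a5 t ((t5 t).2 (h ▸ ht)))
  have m3 : q1 ≠ p5 := fun h => dj q1 b1 (h ▸ a5)
  have m4 : q1 ≠ q5 := fun h => dj q1 b1 (fun t ht => a5 t ((t5 t).2 (h ▸ ht)))
  have h4 : 4 ≤ E.ncard := by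
    rcases c1 with ⟨p, q⟩ | ⟨p, q⟩ <;> rcases c2 with ⟨r, s⟩ | ⟨r, s⟩
    · exact four E p q r s n02 n04 n06 n24 n26 n46
    · exact four E p q r s n02 (nDU _ d0 _ u5) (nDU _ d0 _ v5) (nDU _ d2 _ u5)
        (nDU _ d2 _ v5) n5.symm
    · exact four E p q r s n1.symm (nDU _ d4 _ u1).symm (nDU _ d6 _ u1).symm
        (nDU _ d4 _ v1).symm (nDU _ d6 _ v1).symm n46
    · exact four E p q r s n1.symm m1 m2 m3 m4 n5.symm
  omega

theorem no_P8 [Fintype V] (G : SimpleGraph V) (perf : ∀ S : Set V, MinDeg2 G S → Perf G S)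
    (D : Set V) (hD : ∀ x ∈ D, ∀ y ∈ D, ¬ G.Adj x y)
    (hU : ∀ u ∉ D, ∀ w ∉ D, ¬ G.Adj u w)
    (h2 : ∀ u ∉ D, ∃ x ∈ D, ∃ y ∈ D, x ≠ y ∧ ∀ w, G.Adj u w ↔ w = x ∨ w = y)
    (htw : ∀ u ∉ D, ∃ u' ∉ D, u' ≠ u ∧ ∀ w, G.Adj u w ↔ G.Adj u' w) :
    ¬ containsSub (SimpleGraph.pathGraph 8) G := by
  rintro ⟨φ, hinj, hadj⟩
  have e0 : G.Adj (φ 0) (φ 1) := hadj _ _ (by simp [SimpleGraph.pathGraph_adj])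
  have e1 : G.Adj (φ 1) (φ 2) := hadj _ _ (by simp [SimpleGraph.pathGraph_adj])
  have e2 : G.Adj (φ 2) (φ 3) := hadj _ _ (by simp [SimpleGraph.pathGraph_adj])
  have e3 : G.Adj (φ 3) (φ 4) := hadj _ _ (by simp [SimpleGraph.pathGraph_adj])
  have e4 : G.Adj (φ 4) (φ 5) := hadj _ _ (by simp [SimpleGraph.pathGraph_adj])
  have e5 : G.Adj (φ 5) (φ 6) := hadj _ _ (by simp [SimpleGraph.pathGraph_adj])
  have e6 : G.Adj (φ 6) (φ 7) := hadj _ _ (by simp [SimpleGraph.pathGraph_adj])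
  have alt : ∀ x y, G.Adj x y → (x ∈ D ↔ y ∉ D) := by
    intro x y h
    by_cases hx : x ∈ D <;> by_cases hy : y ∈ D
    · exact absurd h (hD x hx y hy)
    · tauto
    · tauto
    · exact absurd h (hU x hx y hy)
  have a0 := alt _ _ e0
  have a1 := alt _ _ e1
  have a2 := alt _ _ e2
  have a3 := alt _ _ e3
  have a4 := alt _ _ e4
  have a5 := alt _ _ e5
  have a6 := alt _ _ e6
  by_cases h : φ 0 ∈ D
  · exact no_P7 G perf D hD h2 htw (φ 0) (φ 1) (φ 2) (φ 3) (φ 4) (φ 5) (φ 6)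
      (by simp [hinj.eq_iff]) (by grind) (by grind) (by grind) (by grind) e0 e1 e2 e3 e4 e5
  · exact no_P7 G perf D hD h2 htw (φ 1) (φ 2) (φ 3) (φ 4) (φ 5) (φ 6) (φ 7)
      (by simp [hinj.eq_iff]) (by grind) (by grind) (by grind) (by grind) e1 e2 e3 e4 e5 e6

end S16

/-- A connected graph `G` with `δ(G) ≥ 2` is `(γ,γ₂)`-perfect (every induced
subgraph of minimum degree at least 2 satisfies `γ = γ₂`) iff `G` contains no
subgraph isomorphic to `T₆`, to `P₈`, or to `C_m` for any `m ≥ 3`, `m ≠ 4`. -/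
theorem stmt_16 {V : Type*} [Fintype V] (G : SimpleGraph V)
    (hconn : G.Connected) (hδ : ∀ x : V, 2 ≤ (G.neighborSet x).ncard) :
    (∀ s : Finset V,
        (∀ x : (↑s : Set V), 2 ≤ ((G.induce (↑s : Set V)).neighborSet x).ncard) →
        kDomNum (G.induce (↑s : Set V)) 1 = kDomNum (G.induce (↑s : Set V)) 2) ↔
      (¬ containsSub T6 G ∧ ¬ containsSub (SimpleGraph.pathGraph 8) G ∧
       ∀ m : ℕ, 3 ≤ m → m ≠ 4 → ¬ containsSub (cycleG m) G) := by
  have hd : ∀ v, ∃ x y, x ≠ y ∧ G.Adj v x ∧ G.Adj v y := by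
    intro v
    obtain ⟨x, hx, y, hy, hxy⟩ := (S16.two_le_iff _).1 (hδ v)
    exact ⟨x, y, hxy, hx, hy⟩
  simp only [S16.bridge, S16.bridge_deg]
  constructor
  · intro h
    have perf : ∀ S : Set V, S16.MinDeg2 G S → S16.Perf G S := by
      intro S
      have := h (Set.toFinite S).toFinset
      simpa using this
    have hC : ∀ m : ℕ, 3 ≤ m → m ≠ 4 → ¬ containsSub (cycleG m) G := fun m h1 h2 h3 =>
      S16.no_cyc G perf m h1 h2 (S16.hasCyc_of G m h1 h3)
    obtain ⟨D, hD, hU, h2, htw⟩ := S16.dstruct G perf hd hC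
    exact ⟨S16.no_T6 G D hD h2, S16.no_P8 G perf D hD hU h2 htw, hC⟩
  · rintro ⟨hT, hP, hC⟩ s hs
    obtain ⟨a, h2, h3⟩ := S16.struct G hconn hd hT hP hC
    exact S16.perf_of_struct G hC a h2 h3 _ hs
end

section
/- Let X = {x₁,…,x_k} be Boolean variables and 𝒞 = {C₁,…,C_ℓ} a collection of clauses, each consisting of exactly 3 literals over distinct variables of X, such that for every three variables there exists a clause of 𝒞 containing none of them (in positive or negated form). Construct the graph G with vertex set {x_i^t, x_i^f, v_i : 1 ≤ i ≤ k} ∪ {c_j : 1 ≤ j ≤ ℓ} ∪ {c*, v_{k+1}, v₀} and the following edges: x_i^t v_i and x_i^f v_i for all i; c_j x_i^t whenever the literal x_i occurs in C_j, and c_j x_i^f whenever the literal ¬x_i occurs in C_j; c* x_i^t and c* x_i^f for all i; c_j v_{k+1} for all j, and c* v_{k+1}; and v₀ adjacent to every vertex of V(G) ∖ {v₀, v₁,…,v_{k+1}}. Then γ₂(G) = k + 2, and 𝒞 is satisfiable if and only if γ(G) < γ₂(G). -/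
/-- Vertex type of the 3-SAT graph: `Sum.inl (i, 0) = xᵢᵗ`, `Sum.inl (i, 1) = xᵢᶠ`,
`Sum.inl (i, 2) = vᵢ`; `Sum.inr (Sum.inl j) = c_j`; `Sum.inr (Sum.inr 0) = c*`,
`Sum.inr (Sum.inr 1) = v_{k+1}`, `Sum.inr (Sum.inr 2) = v₀`. -/
abbrev SatV (k ℓ : ℕ) := (Fin k × Fin 3) ⊕ (Fin ℓ ⊕ Fin 3)

/-- The graph constructed from the 3-SAT instance given by `vars` and `sign`
(clause `j` consists of the literals with variables `vars j m`, positive when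
`sign j m = true`): edges `xᵢᵗvᵢ`, `xᵢᶠvᵢ`; `c_j xᵢᵗ` when `xᵢ ∈ C_j` and
`c_j xᵢᶠ` when `¬xᵢ ∈ C_j`; `c* xᵢᵗ`, `c* xᵢᶠ`; `c_j v_{k+1}`, `c* v_{k+1}`;
and `v₀` joined to all of `xᵢᵗ, xᵢᶠ, c_j, c*`. -/
def satGraph (k ℓ : ℕ) (vars : Fin ℓ → Fin 3 → Fin k) (sign : Fin ℓ → Fin 3 → Bool) :
    SimpleGraph (SatV k ℓ) :=
  SimpleGraph.fromRel (fun a b =>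
    match a, b with
    | Sum.inl (i, b), Sum.inl (i', b') => i = i' ∧ b ≠ 2 ∧ b' = 2
    | Sum.inr (Sum.inl j), Sum.inl (i, b) =>
        (b = 0 ∧ ∃ m, vars j m = i ∧ sign j m = true) ∨
        (b = 1 ∧ ∃ m, vars j m = i ∧ sign j m = false)
    | Sum.inr (Sum.inr s), Sum.inl (_, b) => (s = 0 ∨ s = 2) ∧ b ≠ 2
    | Sum.inr (Sum.inr s), Sum.inr (Sum.inl _) => s = 1 ∨ s = 2
    | Sum.inr (Sum.inr s), Sum.inr (Sum.inr s') => (s = 1 ∨ s = 2) ∧ s' = 0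
    | _, _ => False)

theorem dom_one {V : Type*} [Finite V] (G : SimpleGraph V) (D : Set V) :
    kDomSet G 1 D ↔ ∀ v ∉ D, ∃ w ∈ D, G.Adj v w := by
  unfold kDomSet
  refine forall₂_congr fun v _ => ?_
  rw [Nat.one_le_iff_ne_zero, ← Nat.pos_iff_ne_zero, Set.ncard_pos]
  rfl

theorem dom_two {V : Type*} [Finite V] (G : SimpleGraph V) (D : Set V) :
    kDomSet G 2 D ↔ ∀ v ∉ D, ∃ w ∈ D, ∃ u ∈ D, w ≠ u ∧ G.Adj v w ∧ G.Adj v u := by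
  unfold kDomSet
  refine forall₂_congr fun v _ => ?_
  rw [show (2 ≤ (D ∩ G.neighborSet v).ncard) = (1 < (D ∩ G.neighborSet v).ncard) from rfl,
    Set.one_lt_ncard]
  simp only [Set.mem_inter_iff, SimpleGraph.mem_neighborSet]
  constructor
  · rintro ⟨a, ⟨ha, ha'⟩, b, ⟨hb, hb'⟩, h⟩
    exact ⟨a, ha, b, hb, h, ha', hb'⟩
  · rintro ⟨a, ha, b, hb, h, ha', hb'⟩
    exact ⟨a, ⟨ha, ha'⟩, b, ⟨hb, hb'⟩, h⟩

/-- the candidate sets -/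
def candSet {k ℓ : ℕ} (g : Fin k → Fin 3) (d : Fin ℓ ⊕ Fin 3) : Set (SatV k ℓ) :=
  Set.range (fun o : Option (Fin k) => o.elim (Sum.inr d : SatV k ℓ) (fun i => Sum.inl (i, g i)))

theorem mem_cand_l {k ℓ : ℕ} (g : Fin k → Fin 3) (d : Fin ℓ ⊕ Fin 3) (i b) :
    (Sum.inl (i, b) : SatV k ℓ) ∈ candSet g d ↔ b = g i := by
  simp [candSet, Option.exists, eq_comm]

theorem mem_cand_r {k ℓ : ℕ} (g : Fin k → Fin 3) (d : Fin ℓ ⊕ Fin 3) (e) :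
    (Sum.inr e : SatV k ℓ) ∈ candSet g d ↔ e = d := by
  simp [candSet, Option.exists, eq_comm]

theorem ncard_cand {k ℓ : ℕ} (g : Fin k → Fin 3) (d : Fin ℓ ⊕ Fin 3) :
    (candSet g d : Set (SatV k ℓ)).ncard = k + 1 := by
  unfold candSet
  rw [Set.ncard_eq_toFinset_card', Set.toFinset_range, Finset.card_image_of_injective]
  · simp
  · rintro (_ | a) (_ | b) h <;> simp_all

theorem cand_struct {k ℓ : ℕ} (vars : Fin ℓ → Fin 3 → Fin k) (sign : Fin ℓ → Fin 3 → Bool)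
    (D : Set (SatV k ℓ)) (h : ∀ v ∉ D, ∃ w ∈ D, (satGraph k ℓ vars sign).Adj v w)
    (hc : D.ncard ≤ k + 1) : ∃ g d, d ≠ Sum.inr 2 ∧ D = candSet g d := by
  have h1 : ∀ i, ∃ b, (Sum.inl (i, b) : SatV k ℓ) ∈ D := by
    intro i
    by_contra! hh
    obtain ⟨w, hw, ha⟩ := h _ (hh 2)
    rcases w with ⟨i', b⟩ | j | s
    · simp [satGraph, SimpleGraph.fromRel_adj] at ha
      obtain rfl := ha.2.1
      exact hh _ hw
    · simp [satGraph, SimpleGraph.fromRel_adj] at ha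
    · simp [satGraph, SimpleGraph.fromRel_adj] at ha
  have h2 : ∃ d, d ≠ Sum.inr 2 ∧ (Sum.inr d : SatV k ℓ) ∈ D := by
    by_contra! hh
    obtain ⟨w, hw, ha⟩ := h _ (hh (Sum.inr 1) (by simp))
    rcases w with ⟨i', b⟩ | j | s
    · simp [satGraph, SimpleGraph.fromRel_adj] at ha
    · exact hh _ (by simp) hw
    · refine hh _ ?_ hw
      rintro h
      simp at h
      subst h
      simp [satGraph, SimpleGraph.fromRel_adj] at ha
  choose g hg using h1
  obtain ⟨d, hd, hd'⟩ := h2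
  refine ⟨g, d, hd, (Set.eq_of_subset_of_ncard_le ?_ ?_).symm⟩
  · rintro _ ⟨_ | i, rfl⟩
    · exact hd'
    · exact hg i
  · rw [ncard_cand]; exact hc

theorem kDomNum_le {V : Type*} [Fintype V] (G : SimpleGraph V) (n : ℕ) (D : Set V)
    (h : kDomSet G n D) : kDomNum G n ≤ D.ncard := Nat.sInf_le ⟨D, h, rfl⟩

theorem kDomNum_spec {V : Type*} [Fintype V] (G : SimpleGraph V) (n : ℕ) :
    ∃ D, kDomSet G n D ∧ D.ncard = kDomNum G n :=
  Nat.sInf_mem (s := {n' | ∃ D : Set V, kDomSet G n D ∧ D.ncard = n'})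
    ⟨_, Set.univ, fun v hv => absurd (Set.mem_univ v) hv, rfl⟩

theorem two_le {k ℓ : ℕ} (vars : Fin ℓ → Fin 3 → Fin k) (sign : Fin ℓ → Fin 3 → Bool) :
    kDomNum (satGraph k ℓ vars sign) 2 ≤ k + 2 := by
  have hcard : (insert (Sum.inr (Sum.inr 2)) (candSet (fun _ => 2) (Sum.inr 1)) :
      Set (SatV k ℓ)).ncard = k + 2 := by
    rw [Set.ncard_insert_of_notMem, ncard_cand]
    rw [mem_cand_r]; simp
  rw [← hcard]
  apply kDomNum_le
  rw [dom_two]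
  intro v hv
  refine (?_ : ∃ u ∈ candSet (fun _ => 2) (Sum.inr 1), u ≠ Sum.inr (Sum.inr 2) ∧
    (satGraph k ℓ vars sign).Adj v u ∧
    (satGraph k ℓ vars sign).Adj v (Sum.inr (Sum.inr 2))).elim ?_
  · rcases v with ⟨i, b⟩ | j | s
    · simp [mem_cand_l] at hv
      exact ⟨Sum.inl (i, 2), by simp [mem_cand_l], by simp,
        by simp [satGraph, SimpleGraph.fromRel_adj, hv],
        by simp [satGraph, SimpleGraph.fromRel_adj, hv]⟩
    · exact ⟨Sum.inr (Sum.inr 1), by simp [mem_cand_r], by simp,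
        by simp [satGraph, SimpleGraph.fromRel_adj],
        by simp [satGraph, SimpleGraph.fromRel_adj]⟩
    · simp [mem_cand_r] at hv
      have : s = 0 := by omega
      subst this
      exact ⟨Sum.inr (Sum.inr 1), by simp [mem_cand_r], by simp,
        by simp [satGraph, SimpleGraph.fromRel_adj],
        by simp [satGraph, SimpleGraph.fromRel_adj]⟩
  · rintro u ⟨hu, hne, h1, h2⟩
    exact ⟨u, Or.inr hu, _, Or.inl rfl, hne, h1, h2⟩

theorem two_ge {k ℓ : ℕ} (vars : Fin ℓ → Fin 3 → Fin k) (sign : Fin ℓ → Fin 3 → Bool) :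
    k + 2 ≤ kDomNum (satGraph k ℓ vars sign) 2 := by
  obtain ⟨D, hD, hc⟩ := kDomNum_spec (satGraph k ℓ vars sign) 2
  rw [dom_two] at hD
  by_contra! hlt
  obtain ⟨g, d, hd, rfl⟩ := cand_struct vars sign D
    (fun v hv => by obtain ⟨w, hw, _, _, _, ha, _⟩ := hD v hv; exact ⟨w, hw, ha⟩) (by omega)
  have hg : ∀ i, g i = 2 := by
    intro i
    by_contra hi
    obtain ⟨w, hw, u, hu, hne, h1, h2⟩ := hD (Sum.inl (i, 2)) (by rw [mem_cand_l]; exact Ne.symm hi)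
    have key : ∀ w ∈ candSet g d, (satGraph k ℓ vars sign).Adj (Sum.inl (i, 2)) w →
        w = Sum.inl (i, g i) := by
      rintro (⟨i', b⟩ | j | s) hw ha
      · rw [mem_cand_l] at hw
        simp [satGraph, SimpleGraph.fromRel_adj] at ha
        rw [hw, ha.2.1]
      · simp [satGraph, SimpleGraph.fromRel_adj] at ha
      · simp [satGraph, SimpleGraph.fromRel_adj] at ha
    exact hne ((key _ hw h1).trans (key _ hu h2).symm)
  have hd1 : d = Sum.inr 1 := by
    by_contra hi
    obtain ⟨w, hw, u, hu, hne, h1, h2⟩ := hD (Sum.inr (Sum.inr 1))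
      (by rw [mem_cand_r]; exact Ne.symm hi)
    have key : ∀ w ∈ candSet g d, (satGraph k ℓ vars sign).Adj (Sum.inr (Sum.inr 1)) w →
        w = Sum.inr d := by
      rintro (⟨i', b⟩ | e) hw ha
      · simp [satGraph, SimpleGraph.fromRel_adj] at ha
      · rw [mem_cand_r] at hw
        rw [hw]
    exact hne ((key _ hw h1).trans (key _ hu h2).symm)
  subst hd1
  obtain ⟨w, hw, u, hu, hne, h1, h2⟩ := hD (Sum.inr (Sum.inr 0))
      (by rw [mem_cand_r]; simp)
  have key : ∀ w ∈ candSet g (Sum.inr 1), (satGraph k ℓ vars sign).Adj (Sum.inr (Sum.inr 0)) w →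
      w = Sum.inr (Sum.inr 1) := by
    rintro (⟨i', b⟩ | e) hw ha
    · rw [mem_cand_l, hg] at hw
      simp [satGraph, SimpleGraph.fromRel_adj, hw] at ha
    · rw [mem_cand_r] at hw
      rw [hw]
  exact hne ((key _ hw h1).trans (key _ hu h2).symm)

theorem sat_le {k ℓ : ℕ} (vars : Fin ℓ → Fin 3 → Fin k) (sign : Fin ℓ → Fin 3 → Bool)
    (φ : Fin k → Bool) (hφ : ∀ j : Fin ℓ, ∃ m : Fin 3, φ (vars j m) = sign j m) :
    kDomNum (satGraph k ℓ vars sign) 1 ≤ k + 1 := by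
  rw [← ncard_cand (k := k) (ℓ := ℓ) (fun i => if φ i then 0 else 1) (Sum.inr 0)]
  apply kDomNum_le
  rw [dom_one]
  rintro (⟨i, b⟩ | j | s) hv
  · by_cases hb : b = 2
    · subst hb
      refine ⟨Sum.inl (i, if φ i then 0 else 1), by rw [mem_cand_l], ?_⟩
      cases h : φ i <;> simp [satGraph, SimpleGraph.fromRel_adj]
    · exact ⟨Sum.inr (Sum.inr 0), by rw [mem_cand_r],
        by simp [satGraph, SimpleGraph.fromRel_adj, hb]⟩
  · obtain ⟨m, hm⟩ := hφ j
    refine ⟨Sum.inl (vars j m, if φ (vars j m) then 0 else 1), by rw [mem_cand_l], ?_⟩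
    cases h : φ (vars j m)
    · simp [satGraph, SimpleGraph.fromRel_adj]
      exact ⟨m, rfl, by rw [← hm, h]⟩
    · simp [satGraph, SimpleGraph.fromRel_adj]
      exact ⟨m, rfl, by rw [← hm, h]⟩
  · refine ⟨Sum.inr (Sum.inr 0), by rw [mem_cand_r], ?_⟩
    simp [mem_cand_r] at hv
    have : s = 1 ∨ s = 2 := by omega
    simp [satGraph, SimpleGraph.fromRel_adj, hv, this]

theorem sat_of {k ℓ : ℕ} (vars : Fin ℓ → Fin 3 → Fin k) (sign : Fin ℓ → Fin 3 → Bool)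
    (havoid : ∀ a b c : Fin k, ∃ j : Fin ℓ, ∀ m : Fin 3,
      vars j m ≠ a ∧ vars j m ≠ b ∧ vars j m ≠ c)
    (hlt : kDomNum (satGraph k ℓ vars sign) 1 < k + 2) :
    ∃ φ : Fin k → Bool, ∀ j : Fin ℓ, ∃ m : Fin 3, φ (vars j m) = sign j m := by
  obtain ⟨D, hD, hc⟩ := kDomNum_spec (satGraph k ℓ vars sign) 1
  rw [dom_one] at hD
  obtain ⟨g, d, hd, rfl⟩ := cand_struct vars sign D hD (by omega)
  -- a clause vertex is dominated by a literal, by d itself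
  have hcl : ∀ j, d ≠ Sum.inl j → d ≠ Sum.inr 1 →
      ∃ m, g (vars j m) = if sign j m then 0 else 1 := by
    intro j hj hd1
    obtain ⟨w, hw, ha⟩ := hD (Sum.inr (Sum.inl j)) (by rw [mem_cand_r]; exact Ne.symm hj)
    rcases w with ⟨i, b⟩ | j' | s
    · rw [mem_cand_l] at hw
      simp [satGraph, SimpleGraph.fromRel_adj] at ha
      rcases ha with ⟨hb, m, rfl, hs⟩ | ⟨hb, m, rfl, hs⟩
      · exact ⟨m, by rw [← hw, hb, hs]; rfl⟩
      · exact ⟨m, by rw [← hw, hb, hs]; rfl⟩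
    · simp [satGraph, SimpleGraph.fromRel_adj] at ha
    · rw [mem_cand_r] at hw
      simp [satGraph, SimpleGraph.fromRel_adj] at ha
      rcases ha with rfl | rfl
      · exact absurd hw.symm hd1
      · exact absurd hw.symm hd
  -- the opposite literal is dominated by d
  have hop : ∀ i, g i ≠ 2 → ∃ b, b ≠ 2 ∧
      (satGraph k ℓ vars sign).Adj (Sum.inl (i, b)) (Sum.inr d) := by
    intro i hi
    obtain ⟨b, hb2, hbg⟩ : ∃ b : Fin 3, b ≠ 2 ∧ b ≠ g i := by
      generalize g i = t
      revert t; decide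
    refine ⟨b, hb2, ?_⟩
    obtain ⟨w, hw, ha⟩ := hD (Sum.inl (i, b)) (by rw [mem_cand_l]; exact hbg)
    rcases w with ⟨i', b'⟩ | e
    · rw [mem_cand_l] at hw
      simp [satGraph, SimpleGraph.fromRel_adj] at ha
      rcases ha.2 with ⟨rfl, _, h2⟩ | ⟨_, _, h2⟩
      · exact absurd (hw.symm.trans h2) hi
      · exact absurd h2 hb2
    · rw [mem_cand_r] at hw
      rwa [← hw]
  rcases d with j | s
  · exfalso
    obtain ⟨j', hj'⟩ := havoid (vars j 0) (vars j 1) (vars j 2)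
    have hne : (Sum.inl j : Fin ℓ ⊕ Fin 3) ≠ Sum.inl j' := by
      intro h
      obtain rfl := Sum.inl.inj h
      exact (hj' 0).1 rfl
    obtain ⟨m, hm⟩ := hcl j' hne (by simp)
    obtain ⟨b, _, ha⟩ := hop (vars j' m) (by rw [hm]; split <;> decide)
    have : ∃ m', vars j m' = vars j' m := by
      simp [satGraph, SimpleGraph.fromRel_adj] at ha
      rcases ha with ⟨_, m', h, _⟩ | ⟨_, m', h, _⟩ <;> exact ⟨m', h⟩
    obtain ⟨m', hm'⟩ := this
    have := hj' m
    fin_cases m'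
    · exact this.1 hm'.symm
    · exact this.2.1 hm'.symm
    · exact this.2.2 hm'.symm
  · have hs : s = 0 ∨ s = 1 := by
      have : s ≠ 2 := fun h => hd (by rw [h])
      omega
    rcases hs with rfl | rfl
    · refine ⟨fun i => decide (g i = 0), fun j => ?_⟩
      obtain ⟨m, hm⟩ := hcl j (by simp) (by simp)
      refine ⟨m, ?_⟩
      cases h : sign j m <;> simp [hm, h]
    · exfalso
      have hg : ∀ i, g i = 2 := by
        intro i
        by_contra hi
        obtain ⟨b, _, ha⟩ := hop i hi
        simp [satGraph, SimpleGraph.fromRel_adj] at ha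
      obtain ⟨w, hw, ha⟩ := hD (Sum.inr (Sum.inr 2)) (by rw [mem_cand_r]; simp)
      rcases w with ⟨i', b'⟩ | e
      · rw [mem_cand_l, hg] at hw
        simp [satGraph, SimpleGraph.fromRel_adj, hw] at ha
      · rw [mem_cand_r] at hw
        simp [satGraph, SimpleGraph.fromRel_adj, hw] at ha

/-- For a 3-SAT instance whose clauses each consist of 3 literals over distinct
variables, such that every three variables avoid some clause, the constructed
graph `G` satisfies `γ₂(G) = k + 2`, and the instance is satisfiable iff
`γ(G) < γ₂(G)`. -/
theorem stmt_17 (k ℓ : ℕ)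
    (vars : Fin ℓ → Fin 3 → Fin k) (sign : Fin ℓ → Fin 3 → Bool)
    (hdistinct : ∀ j, Function.Injective (vars j))
    (havoid : ∀ a b c : Fin k, ∃ j : Fin ℓ, ∀ m : Fin 3,
      vars j m ≠ a ∧ vars j m ≠ b ∧ vars j m ≠ c) :
    kDomNum (satGraph k ℓ vars sign) 2 = k + 2 ∧
    ((∃ φ : Fin k → Bool, ∀ j : Fin ℓ, ∃ m : Fin 3, φ (vars j m) = sign j m) ↔
      kDomNum (satGraph k ℓ vars sign) 1 < kDomNum (satGraph k ℓ vars sign) 2) := by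
  have h2 : kDomNum (satGraph k ℓ vars sign) 2 = k + 2 :=
    le_antisymm (two_le vars sign) (two_ge vars sign)
  refine ⟨h2, ?_⟩
  rw [h2]
  constructor
  · rintro ⟨φ, hφ⟩
    exact Nat.lt_succ_of_le (sat_le vars sign φ hφ)
  · exact sat_of vars sign havoid
end
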